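/- arXiv:1006.4690 — 7 statements merged into one kernel-verified Lean document; each statement's English description precedes it below -/
import Mathlib

section
/- For each 1 ≤ i ≤ m, the saturation Sᵢ := {a ∈ A : |at − s|ᵢ < |s|ᵢ for some s, t ∈ S} is a multiplicatively closed subset of A containing S; that is, S ⊆ Sᵢ, 1 ∈ Sᵢ, 0 ∉ Sᵢ, and a, b ∈ Sᵢ implies ab ∈ Sᵢ. -/
/-- A multiplicative nonarchimedean norm on a (possibly noncommutative) unital ring. -/
def IsMultNorm {A : Type*} [Ring A] (f : A → ℝ) : Prop :=
  (∀ a, 0 ≤ f a) ∧ (∀ a, f a = 0 ↔ a = 0) ∧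
  (∀ a b, f (a + b) ≤ max (f a) (f b)) ∧ f 1 = 1 ∧
  (∀ a b, f (a * b) = f a * f b)

/-- A quasi-abelian multiplicative norm: `|ab - ba| ≤ γ·|ab|` for some `0 < γ < 1`. -/
def IsQuasiAbelian {A : Type*} [Ring A] (f : A → ℝ) : Prop :=
  IsMultNorm f ∧ ∃ γ : ℝ, 0 < γ ∧ γ < 1 ∧ ∀ a b, f (a * b - b * a) ≤ γ * f (a * b)

/-- The saturation of `S` with respect to the norm `f`. -/
def Sat {A : Type*} [Ring A] (f : A → ℝ) (S : Set A) : Set A :=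
  {a | ∃ s ∈ S, ∃ t ∈ S, f (a * t - s) < f s}

namespace IsMultNorm

variable {A : Type*} [Ring A] {f : A → ℝ}

theorem map_neg (hf : IsMultNorm f) (a : A) : f (-a) = f a := by
  obtain ⟨h0, -, -, h1, hmul⟩ := hf
  have hsq : f (-1) * f (-1) = 1 := by rw [← hmul]; simpa using h1
  have hone : f (-1) = 1 := by nlinarith [h0 (-1)]
  rw [← neg_one_mul, hmul, hone, one_mul]

theorem pos (hf : IsMultNorm f) {a : A} (ha : a ≠ 0) : 0 < f a :=
  lt_of_le_of_ne (hf.1 a) fun h => ha ((hf.2.1 a).1 h.symm)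

theorem le_of_sub_lt (hf : IsMultNorm f) {a b : A} (h : f (a - b) < f b) : f a ≤ f b := by
  simpa [h.le] using hf.2.2.1 (a - b) b

theorem subset_sat (hf : IsMultNorm f) {S : Set A} (h1 : (1 : A) ∈ S) (h0 : (0 : A) ∉ S) :
    S ⊆ Sat f S := by
  intro a ha
  refine ⟨a, ha, 1, h1, ?_⟩
  rw [mul_one, sub_self, (hf.2.1 0).2 rfl]
  exact hf.pos (ne_of_mem_of_not_mem ha h0)

theorem zero_notMem_sat (hf : IsMultNorm f) (S : Set A) : (0 : A) ∉ Sat f S := by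
  rintro ⟨s, -, t, -, h⟩
  rw [zero_mul, zero_sub, hf.map_neg] at h
  exact lt_irrefl _ h

end IsMultNorm

theorem IsQuasiAbelian.mul_mem_sat {A : Type*} [Ring A] {f : A → ℝ} (hf : IsQuasiAbelian f)
    {S : Set A} (h0S : (0 : A) ∉ S) (hS : ∀ a ∈ S, ∀ b ∈ S, a * b ∈ S) {a b : A}
    (ha : a ∈ Sat f S) (hb : b ∈ Sat f S) : a * b ∈ Sat f S := by
  obtain ⟨hN, γ, hγ0, hγ1, hγ⟩ := hf
  obtain ⟨s, hs, t, ht, hst⟩ := ha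
  obtain ⟨v, hv, u, hu, hvu⟩ := hb
  refine ⟨s * v, hS s hs v hv, t * u, hS t ht u hu, ?_⟩
  have hs0 := hN.pos (ne_of_mem_of_not_mem hs h0S)
  have hv0 := hN.pos (ne_of_mem_of_not_mem hv h0S)
  have hat := hN.le_of_sub_lt hst
  have hbu := hN.le_of_sub_lt hvu
  obtain ⟨hnn, -, hadd, -, hmul⟩ := hN
  have hcomm : f (a * (b * t - t * b) * u) < f s * f v := by
    calc f (a * (b * t - t * b) * u) = f a * f (b * t - t * b) * f u := by rw [hmul, hmul]
      _ ≤ f a * (γ * f (b * t)) * f u :=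
        mul_le_mul_of_nonneg_right (mul_le_mul_of_nonneg_left (hγ b t) (hnn a)) (hnn u)
      _ = γ * (f (a * t) * f (b * u)) := by simp only [hmul]; ring
      _ ≤ γ * (f s * f v) :=
        mul_le_mul_of_nonneg_left (mul_le_mul hat hbu (hnn _) hs0.le) hγ0.le
      _ < f s * f v := mul_lt_of_lt_one_left (mul_pos hs0 hv0) hγ1
  have hleft : f ((a * t - s) * (b * u)) < f s * f v := by
    rw [hmul]
    exact (mul_le_mul_of_nonneg_left hbu (hnn _)).trans_lt (mul_lt_mul_of_pos_right hst hv0)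
  have hright : f (s * (b * u - v)) < f s * f v := by
    rw [hmul]
    exact mul_lt_mul_of_pos_left hvu hs0
  have hsplit : a * b * (t * u) - s * v =
      a * (b * t - t * b) * u + ((a * t - s) * (b * u) + s * (b * u - v)) := by
    noncomm_ring
  rw [hmul s v, hsplit]
  exact (hadd _ _).trans_lt (max_lt hcomm ((hadd _ _).trans_lt (max_lt hleft hright)))

theorem statement1 {A : Type*} [Ring A] {m : ℕ} (hm : 0 < m)
    (f : Fin m → A → ℝ) (hf : ∀ i, IsQuasiAbelian (f i))
    (S : Set A) (h1S : (1 : A) ∈ S) (h0S : (0 : A) ∉ S)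
    (hS : ∀ a ∈ S, ∀ b ∈ S, a * b ∈ S) (i : Fin m) :
    S ⊆ Sat (f i) S ∧ (1 : A) ∈ Sat (f i) S ∧ (0 : A) ∉ Sat (f i) S ∧
      ∀ a ∈ Sat (f i) S, ∀ b ∈ Sat (f i) S, a * b ∈ Sat (f i) S := by
  have hN := (hf i).1
  have hsub := hN.subset_sat h1S h0S
  exact ⟨hsub, hsub h1S, hN.zero_notMem_sat S, fun _ ha _ hb => (hf i).mul_mem_sat h0S hS ha hb⟩
end

section
/- For every ε > 0 and every x ∈ S × A there exists ξ = (t, b) ∈ S × A such that Δᵢ(x, ξ) ≤ ε for all 1 ≤ i ≤ m, where for x = (s, a) one sets Δᵢ(x, ξ) := |s|ᵢ⁻¹·|t|ᵢ⁻¹·|at − sb|ᵢ. -/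
/-- `Δ(x,y) = |s|⁻¹·|t|⁻¹·|at − sb|` for `x = (s,a)`, `y = (t,b)`. -/
noncomputable def Delta {A : Type*} [Ring A] (f : A → ℝ) (x y : A × A) : ℝ :=
  (f x.1)⁻¹ * (f y.1)⁻¹ * f (x.2 * y.1 - x.1 * y.2)

/-- `dᵢ(x,y)` : the infimum over `ξ ∈ Sᵢ × A` of `max(Δᵢ(x,ξ), Δᵢ(y,ξ))`. -/
noncomputable def dI {A : Type*} [Ring A] (f : A → ℝ) (S : Set A) (x y : A × A) : ℝ :=
  sInf {r : ℝ | ∃ ξ : A × A, ξ.1 ∈ Sat f S ∧ r = max (Delta f x ξ) (Delta f y ξ)}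

/-- Iterating the commutator with `s` shows that `a * s ^ n` is close to the right ideal `s * A`,
with an error that decays geometrically for every quasi-abelian norm. -/
theorem exists_mul_pow_sub_mul_le {A : Type*} [Ring A] (s a : A) (n : ℕ) :
    ∃ b : A, ∀ (f : A → ℝ) (γ : ℝ), 0 ≤ γ → (∀ u v, f (u * v) = f u * f v) → 0 ≤ f s →
      (∀ u v, f (u * v - v * u) ≤ γ * f (u * v)) →
      f (a * s ^ n - s * b) ≤ γ ^ n * (f a * f s ^ n) := by
  induction n with
  | zero => exact ⟨0, fun f γ _ _ _ _ => by simp⟩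
  | succ n ih =>
    obtain ⟨b, hb⟩ := ih
    refine ⟨b * s + (a * s ^ n - s * b), fun f γ hγ hmul hs hcomm => ?_⟩
    have heq : a * s ^ (n + 1) - s * (b * s + (a * s ^ n - s * b)) =
        (a * s ^ n - s * b) * s - s * (a * s ^ n - s * b) := by
      rw [pow_succ]
      noncomm_ring
    calc f (a * s ^ (n + 1) - s * (b * s + (a * s ^ n - s * b)))
        ≤ γ * (f (a * s ^ n - s * b) * f s) := by
          rw [heq, ← hmul]
          exact hcomm _ _
      _ ≤ γ * (γ ^ n * (f a * f s ^ n) * f s) := by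
          gcongr
          exact hb f γ hγ hmul hs hcomm
      _ = γ ^ (n + 1) * (f a * f s ^ (n + 1)) := by ring

theorem IsMultNorm.map_pow {A : Type*} [Ring A] {f : A → ℝ} (hf : IsMultNorm f) (s : A) (n : ℕ) :
    f (s ^ n) = f s ^ n := by
  obtain ⟨-, -, -, h1, hmul⟩ := hf
  induction n with
  | zero => simp [h1]
  | succ n ih => rw [pow_succ, hmul, ih, pow_succ]

theorem statement3 {A : Type*} [Ring A] {m : ℕ} (hm : 0 < m)
    (f : Fin m → A → ℝ) (hf : ∀ i, IsQuasiAbelian (f i))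
    (S : Set A) (h1S : (1 : A) ∈ S) (h0S : (0 : A) ∉ S)
    (hS : ∀ a ∈ S, ∀ b ∈ S, a * b ∈ S)
    (ε : ℝ) (hε : 0 < ε) (x : A × A) (hx : x.1 ∈ S) :
    ∃ ξ : A × A, ξ.1 ∈ S ∧ ∀ i, Delta (f i) x ξ ≤ ε := by
  obtain ⟨s, a⟩ := x
  have hs0 : s ≠ 0 := fun h => h0S (h ▸ hx)
  have hpow : ∀ n : ℕ, s ^ n ∈ S := fun n => by
    induction n with
    | zero => simpa using h1S
    | succ n ih => rw [pow_succ]; exact hS _ ih _ hx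
  choose b hb using exists_mul_pow_sub_mul_le s a
  have hev : ∀ i, ∀ᶠ n in Filter.atTop, Delta (f i) (s, a) (s ^ n, b n) ≤ ε := fun i => by
    obtain ⟨hnorm, γ, hγ0, hγ1, hcomm⟩ := hf i
    have hspos : 0 < f i s :=
      lt_of_le_of_ne (hnorm.1 s) fun h => hs0 ((hnorm.2.1 s).1 h.symm)
    have hlim : Filter.Tendsto (fun n : ℕ => γ ^ n * (f i a * (f i s)⁻¹)) Filter.atTop
        (nhds 0) := by
      simpa using (tendsto_pow_atTop_nhds_zero_of_lt_one hγ0.le hγ1).mul_const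
        (f i a * (f i s)⁻¹)
    filter_upwards [hlim.eventually_le_const hε] with n hn
    refine le_trans ?_ hn
    calc Delta (f i) (s, a) (s ^ n, b n)
        = (f i s)⁻¹ * (f i s ^ n)⁻¹ * f i (a * s ^ n - s * b n) := by
          simp only [Delta, hnorm.map_pow]
      _ ≤ (f i s)⁻¹ * (f i s ^ n)⁻¹ * (γ ^ n * (f i a * f i s ^ n)) := by
          gcongr
          exact hb n (f i) γ hγ0.le hnorm.2.2.2.2 hspos.le hcomm
      _ = γ ^ n * (f i a * (f i s)⁻¹) := by
          field_simp
  obtain ⟨n, hn⟩ := (Filter.eventually_all.2 hev).exists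
  exact ⟨(s ^ n, b n), hpow n, hn⟩
end

section
/- The function d on (S × A)² satisfies the ultrametric triangle inequality: for any x, y, z ∈ S × A one has d(x, z) ≤ max(d(x, y), d(y, z)). -/
/-- `d(x,y) = maxᵢ dᵢ(x,y)`. -/
noncomputable def dGlob {A : Type*} [Ring A] {m : ℕ} (f : Fin m → A → ℝ)
    (S : Set A) (x y : A × A) : ℝ :=
  ⨆ i : Fin m, dI (f i) S x y

namespace IsMultNorm

variable {A : Type*} [Ring A] {f : A → ℝ}

theorem add_le (hf : IsMultNorm f) {a b : A} {r : ℝ} (ha : f a ≤ r) (hb : f b ≤ r) :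
    f (a + b) ≤ r :=
  (hf.2.2.1 a b).trans (max_le ha hb)

theorem sub_le (hf : IsMultNorm f) {a b : A} {r : ℝ} (ha : f a ≤ r) (hb : f b ≤ r) :
    f (a - b) ≤ r := by
  rw [sub_eq_add_neg]
  exact hf.add_le ha ((hf.map_neg b).trans_le hb)

theorem map_pow_s4 (hf : IsMultNorm f) (a : A) (n : ℕ) : f (a ^ n) = f a ^ n := by
  induction n with
  | zero => simpa using hf.2.2.2.1
  | succ n ih => rw [pow_succ, pow_succ, hf.2.2.2.2, ih]

theorem ne_zero_of_mem_sat (hf : IsMultNorm f) {S : Set A} {a : A} (ha : a ∈ Sat f S) :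
    a ≠ 0 := by
  rintro rfl
  obtain ⟨s, -, t, -, h⟩ := ha
  rw [zero_mul, zero_sub, hf.map_neg] at h
  exact h.false

theorem one_mem_sat (hf : IsMultNorm f) {S : Set A} (h : (1 : A) ∈ S) : (1 : A) ∈ Sat f S := by
  refine ⟨1, h, 1, h, ?_⟩
  rw [mul_one, sub_self, (hf.2.1 0).2 rfl, hf.2.2.2.1]
  exact one_pos

theorem delta_nonneg (hf : IsMultNorm f) (x y : A × A) : 0 ≤ Delta f x y :=
  mul_nonneg (mul_nonneg (inv_nonneg.2 (hf.1 _)) (inv_nonneg.2 (hf.1 _))) (hf.1 _)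

theorem delta_le_iff (hf : IsMultNorm f) {x y : A × A} (hx : x.1 ≠ 0) (hy : y.1 ≠ 0) {r : ℝ} :
    Delta f x y ≤ r ↔ f (x.2 * y.1 - x.1 * y.2) ≤ r * (f x.1 * f y.1) := by
  rw [Delta, ← mul_inv, mul_comm, ← div_eq_mul_inv, div_le_iff₀ (mul_pos (hf.pos hx) (hf.pos hy))]

/-- Approximate right Ore condition. -/
theorem exists_mul_pow_sub_le (hf : IsMultNorm f) {γ : ℝ} (hγ : 0 ≤ γ)
    (h : ∀ a b, f (a * b - b * a) ≤ γ * f (a * b)) (s : A) (n : ℕ) (t : A) :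
    ∃ v, f (t * s ^ n - s * v) ≤ γ ^ n * (f t * f (s ^ n)) := by
  induction n generalizing t with
  | zero => exact ⟨0, by simp [hf.2.2.2.1]⟩
  | succ n ih =>
    obtain ⟨w, hw⟩ := ih (t * s - s * t)
    refine ⟨t * s ^ n + w, ?_⟩
    have e : t * s ^ (n + 1) - s * (t * s ^ n + w) = (t * s - s * t) * s ^ n - s * w := by
      rw [pow_succ']; noncomm_ring
    rw [e]
    have hc := h t s
    rw [hf.2.2.2.2] at hc
    calc _ ≤ _ := hw
      _ ≤ γ ^ n * (γ * (f t * f s) * f (s ^ n)) := by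
        gcongr
        exact hf.1 _
      _ = _ := by rw [hf.map_pow_s4, hf.map_pow_s4]; ring

end IsMultNorm

namespace IsQuasiAbelian

variable {A : Type*} [Ring A] {f : A → ℝ}

theorem delta_le (hf : IsQuasiAbelian f) {x y ξ η : A × A} (hx : x.1 ≠ 0) (hy : y.1 ≠ 0)
    (hξ : ξ.1 ≠ 0) (hη : η.1 ≠ 0) {M : ℝ} (hxη : Delta f x η ≤ M) (hyη : Delta f y η ≤ M)
    (hyξ : Delta f y ξ ≤ M) : Delta f x ξ ≤ M := by
  obtain ⟨hN, γ, hγ0, hγ1, hγ⟩ := hf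
  refine le_of_forall_gt_imp_ge_of_dense fun K hK => ?_
  have hK0 : 0 < K := ((hN.delta_nonneg _ _).trans hxη).trans_lt hK
  replace hxη := (hN.delta_le_iff hx hη).1 (hxη.trans hK.le)
  replace hyη := (hN.delta_le_iff hy hη).1 (hyη.trans hK.le)
  replace hyξ := (hN.delta_le_iff hy hξ).1 (hyξ.trans hK.le)
  rw [hN.delta_le_iff hx hξ]
  obtain ⟨s, a⟩ := x
  obtain ⟨s', a'⟩ := y
  obtain ⟨t, b⟩ := ξ
  obtain ⟨t', b'⟩ := η
  dsimp only at *
  have hs := hN.pos hx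
  have hs' := hN.pos hy
  have ht := hN.pos hξ
  have ht' := hN.pos hη
  have small (c r : A) (hr : 0 < f r) : ∀ᶠ n : ℕ in Filter.atTop, f c * γ ^ n ≤ K * f r := by
    have := (tendsto_pow_atTop_nhds_zero_of_lt_one hγ0.le hγ1).const_mul (f c)
    rw [mul_zero] at this
    exact this.eventually_le_const (mul_pos hK0 hr)
  obtain ⟨n, hn, hn'⟩ := ((small a s hs).and (small a' s' hs')).exists
  obtain ⟨v, hv⟩ := hN.exists_mul_pow_sub_le hγ0.le hγ t' n t
  have hu : 0 < f (t' ^ n) := by rw [hN.map_pow_s4]; positivity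
  generalize t' ^ n = u at hv hu
  have hmul := hN.2.2.2.2
  have htv : f t' * f v ≤ f t * f u := by
    rw [← hmul, show t' * v = t * u - (t * u - t' * v) by abel]
    refine hN.sub_le (hmul _ _).le (hv.trans ?_)
    exact mul_le_of_le_one_left (by positivity) (pow_le_one₀ hγ0.le hγ1.le)
  have err (c r : A) (h : f c * γ ^ n ≤ K * f r) :
      f (c * (t * u - t' * v)) ≤ K * f r * (f t * f u) := by
    rw [hmul]
    calc _ ≤ f c * (γ ^ n * (f t * f u)) := mul_le_mul_of_nonneg_left hv (hN.1 c)
      _ = f c * γ ^ n * (f t * f u) := by ring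
      _ ≤ _ := by gcongr
  have cross (e r : A) (hr : 0 < f r) (h : f e ≤ K * (f r * f t')) :
      f (e * v) ≤ K * f r * (f t * f u) := by
    rw [hmul]
    calc _ ≤ K * (f r * f t') * f v := mul_le_mul_of_nonneg_right h (hN.1 v)
      _ = K * f r * (f t' * f v) := by ring
      _ ≤ _ := by gcongr
  have hc : f (b' * v - b * u) ≤ K * (f t * f u) := by
    refine le_of_mul_le_mul_left ?_ hs'
    rw [← hmul, show s' * (b' * v - b * u) = (a' * t - s' * b) * u - (a' * t' - s' * b') * v
      - a' * (t * u - t' * v) by noncomm_ring, show f s' * (K * (f t * f u)) =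
      K * f s' * (f t * f u) by ring]
    refine hN.sub_le (hN.sub_le ?_ (cross _ _ hs' hyη)) (err _ _ hn')
    rw [hmul]
    calc _ ≤ K * (f s' * f t) * f u := by gcongr
      _ = _ := by ring
  refine le_of_mul_le_mul_right ?_ hu
  rw [← hmul, show (a * t - s * b) * u = (a * t' - s * b') * v + s * (b' * v - b * u)
    + a * (t * u - t' * v) by noncomm_ring, show K * (f s * f t) * f u =
    K * f s * (f t * f u) by ring]
  refine hN.add_le (hN.add_le (cross _ _ hs hxη) ?_) (err _ _ hn)
  rw [hmul]
  calc _ ≤ f s * (K * (f t * f u)) := by gcongr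
    _ = _ := by ring

theorem dI_triangle (hf : IsQuasiAbelian f) {S : Set A} (h1S : (1 : A) ∈ S) {x y z : A × A}
    (hx : x.1 ≠ 0) (hy : y.1 ≠ 0) : dI f S x z ≤ max (dI f S x y) (dI f S y z) := by
  have hne (p q : A × A) :
      {r : ℝ | ∃ ξ : A × A, ξ.1 ∈ Sat f S ∧ r = max (Delta f p ξ) (Delta f q ξ)}.Nonempty :=
    ⟨_, (1, 0), hf.1.one_mem_sat h1S, rfl⟩
  refine le_of_forall_gt fun K hK => ?_
  obtain ⟨hK₁, hK₂⟩ := max_lt_iff.1 hK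
  obtain ⟨_, ⟨ξ, hξ, rfl⟩, hr₁⟩ := exists_lt_of_csInf_lt (hne x y) hK₁
  obtain ⟨_, ⟨η, hη, rfl⟩, hr₂⟩ := exists_lt_of_csInf_lt (hne y z) hK₂
  refine lt_of_le_of_lt ?_ (max_lt hr₁ hr₂)
  have hle : dI f S x z ≤ max (Delta f x η) (Delta f z η) := by
    refine csInf_le ⟨0, ?_⟩ ⟨η, hη, rfl⟩
    rintro _ ⟨ζ, -, rfl⟩
    exact le_max_of_le_left (hf.1.delta_nonneg _ _)
  refine hle.trans (max_le ?_ ?_)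
  · exact hf.delta_le hx hy (hf.1.ne_zero_of_mem_sat hη) (hf.1.ne_zero_of_mem_sat hξ)
      (le_max_of_le_left (le_max_left _ _)) (le_max_of_le_left (le_max_right _ _))
      (le_max_of_le_right (le_max_left _ _))
  · exact le_max_of_le_right (le_max_right _ _)

end IsQuasiAbelian

theorem statement4 {A : Type*} [Ring A] {m : ℕ} (hm : 0 < m)
    (f : Fin m → A → ℝ) (hf : ∀ i, IsQuasiAbelian (f i))
    (S : Set A) (h1S : (1 : A) ∈ S) (h0S : (0 : A) ∉ S)
    (hS : ∀ a ∈ S, ∀ b ∈ S, a * b ∈ S)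
    (x y z : A × A) (hx : x.1 ∈ S) (hy : y.1 ∈ S) (hz : z.1 ∈ S) :
    dGlob f S x z ≤ max (dGlob f S x y) (dGlob f S y z) := by
  have : Nonempty (Fin m) := ⟨⟨0, hm⟩⟩
  refine ciSup_le fun i => ?_
  have hne (a : A) (ha : a ∈ S) : a ≠ 0 := fun h => h0S (h ▸ ha)
  exact ((hf i).dI_triangle h1S (hne _ hx) (hne _ hy)).trans
    (max_le_max (le_ciSup (f := fun i => dI (f i) S x y) (Set.finite_range _).bddAbove i)
      (le_ciSup (f := fun i => dI (f i) S y z) (Set.finite_range _).bddAbove i))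
end

section
/- (Common-denominator density.) For any n ≥ 1, any ε > 0 and any x₁, …, xₙ ∈ S × A there exist an element s ∈ S and elements a₁, …, aₙ ∈ A such that d(xⱼ, (s, aⱼ)) < ε for every 1 ≤ j ≤ n. -/
open Filter

section ApproximateOre

variable {A ι : Type*} [Ring A] {f : ι → A → ℝ} {γ : ι → ℝ}

theorem IsMultNorm.map_mul {g : A → ℝ} (hg : IsMultNorm g) (a b : A) : g (a * b) = g a * g b :=
  hg.2.2.2.2 a b

theorem IsMultNorm.map_pos {g : A → ℝ} (hg : IsMultNorm g) {a : A} (ha : a ≠ 0) : 0 < g a :=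
  (hg.1 a).lt_of_ne fun h => ha ((hg.2.1 a).1 h.symm)

/-- Approximate right Ore condition: `a * s ^ N` is close to a right multiple of `s`, uniformly in
a family of norms with small commutators. -/
theorem exists_norm_mul_pow_sub_mul_le (hf : ∀ i, IsMultNorm (f i)) (hγ : ∀ i, 0 ≤ γ i)
    (hcomm : ∀ i a b, f i (a * b - b * a) ≤ γ i * f i (a * b)) (s a : A) (N : ℕ) :
    ∃ b, ∀ i, f i (a * s ^ N - s * b) ≤ γ i ^ N * (f i a * f i (s ^ N)) := by
  induction N with
  | zero => exact ⟨0, fun i => by simp [(hf i).2.2.2.1]⟩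
  | succ N ih =>
    obtain ⟨b, hb⟩ := ih
    refine ⟨b * s + (a * s ^ N - s * b), fun i => ?_⟩
    have key : a * s ^ (N + 1) - s * (b * s + (a * s ^ N - s * b)) =
        (a * s ^ N - s * b) * s - s * (a * s ^ N - s * b) := by
      rw [pow_succ]; noncomm_ring
    rw [key, pow_succ s, (hf i).map_mul (s ^ N)]
    calc _ ≤ γ i * (f i (a * s ^ N - s * b) * f i s) := by
          rw [← (hf i).map_mul]; exact hcomm i _ _
      _ ≤ γ i * (γ i ^ N * (f i a * f i (s ^ N)) * f i s) :=
          mul_le_mul_of_nonneg_left (mul_le_mul_of_nonneg_right (hb i) ((hf i).1 s)) (hγ i)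
      _ = _ := by ring

/-- Approximate left Ore condition: `t ^ N * e` is close to a left multiple of `t`, uniformly in
a family of norms with small commutators. -/
theorem exists_norm_mul_sub_pow_mul_le (hf : ∀ i, IsMultNorm (f i)) (hγ : ∀ i, 0 ≤ γ i)
    (hcomm : ∀ i a b, f i (a * b - b * a) ≤ γ i * f i (a * b)) (t e : A) (N : ℕ) :
    ∃ b, ∀ i, f i (b * t - t ^ N * e) ≤ γ i ^ N * (f i (t ^ N) * f i e) := by
  induction N with
  | zero =>
    refine ⟨0, fun i => ?_⟩
    have h1 : f i (-1) = 1 := by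
      have h := (hf i).map_mul (-1) (-1)
      rw [neg_one_mul, neg_neg, (hf i).2.2.2.1] at h
      nlinarith [(hf i).1 (-1)]
    have h2 := (hf i).map_mul (-1) e
    rw [neg_one_mul, h1] at h2
    simp [(hf i).2.2.2.1, h2]
  | succ N ih =>
    obtain ⟨b, hb⟩ := ih
    refine ⟨t * b - (b * t - t ^ N * e), fun i => ?_⟩
    have key : (t * b - (b * t - t ^ N * e)) * t - t ^ (N + 1) * e =
        t * (b * t - t ^ N * e) - (b * t - t ^ N * e) * t := by
      rw [pow_succ']; noncomm_ring
    rw [key, pow_succ' t, (hf i).map_mul t]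
    calc _ ≤ γ i * (f i t * f i (b * t - t ^ N * e)) := by
          rw [← (hf i).map_mul]; exact hcomm i _ _
      _ ≤ γ i * (f i t * (γ i ^ N * (f i (t ^ N) * f i e))) :=
          mul_le_mul_of_nonneg_left (mul_le_mul_of_nonneg_left (hb i) ((hf i).1 t)) (hγ i)
      _ = _ := by ring

/-- Approximate common left multiples: the product of the `N`-th powers of the members of a list
serves simultaneously for each member of the list. -/
theorem exists_norm_mul_sub_prod_mul_le (hf : ∀ i, IsMultNorm (f i)) (hγ : ∀ i, 0 ≤ γ i)
    (hcomm : ∀ i a b, f i (a * b - b * a) ≤ γ i * f i (a * b)) (N : ℕ) (e t : A) (l : List A)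
    (ht : t ∈ l) :
    ∃ b, ∀ i, f i (b * t - (l.map (· ^ N)).prod * e) ≤
      γ i ^ N * (f i (l.map (· ^ N)).prod * f i e) := by
  induction l with
  | nil => simp at ht
  | cons h l ih =>
    simp only [List.map_cons, List.prod_cons]
    rcases List.mem_cons.1 ht with rfl | ht
    · obtain ⟨b, hb⟩ := exists_norm_mul_sub_pow_mul_le hf hγ hcomm t ((l.map (· ^ N)).prod * e) N
      refine ⟨b, fun i => ?_⟩
      have := hb i
      rwa [← (hf i).map_mul, ← mul_assoc (t ^ N), (hf i).map_mul _ e] at this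
    · obtain ⟨b, hb⟩ := ih ht
      refine ⟨h ^ N * b, fun i => ?_⟩
      rw [mul_assoc, mul_assoc, ← mul_sub, (hf i).map_mul, (hf i).map_mul]
      calc _ ≤ f i (h ^ N) * (γ i ^ N * (f i (l.map (· ^ N)).prod * f i e)) :=
            mul_le_mul_of_nonneg_left (hb i) ((hf i).1 _)
        _ = _ := by ring

/-- The distance between two pairs is controlled by any intermediate pair with denominator
in `S`. -/
theorem dI_le_max_Delta {g : A → ℝ} (hg : IsMultNorm g) {S : Set A} (h1S : (1 : A) ∈ S)
    (h0S : (0 : A) ∉ S) (x y ξ : A × A) (hξ : ξ.1 ∈ S) :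
    dI g S x y ≤ max (Delta g x ξ) (Delta g y ξ) := by
  refine csInf_le ⟨0, ?_⟩ ⟨ξ, ⟨ξ.1, hξ, 1, h1S, ?_⟩, rfl⟩
  · rintro r ⟨η, -, rfl⟩
    exact le_max_of_le_left
      (mul_nonneg (mul_nonneg (inv_nonneg.2 (hg.1 _)) (inv_nonneg.2 (hg.1 _))) (hg.1 _))
  · rw [mul_one, sub_self, (hg.2.1 0).2 rfl]
    exact hg.map_pos fun h => h0S (h ▸ hξ)

end ApproximateOre

theorem statement7 {A : Type*} [Ring A] {m : ℕ} (hm : 0 < m)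
    (f : Fin m → A → ℝ) (hf : ∀ i, IsQuasiAbelian (f i))
    (S : Set A) (h1S : (1 : A) ∈ S) (h0S : (0 : A) ∉ S)
    (hS : ∀ a ∈ S, ∀ b ∈ S, a * b ∈ S)
    (n : ℕ) (hn : 1 ≤ n) (ε : ℝ) (hε : 0 < ε)
    (x : Fin n → A × A) (hx : ∀ j, (x j).1 ∈ S) :
    ∃ s ∈ S, ∃ a : Fin n → A, ∀ j, dGlob f S (x j) (s, a j) < ε := by
  choose hmul γ hγ0 hγ1 hcomm using hf
  have hγ : ∀ i, 0 ≤ γ i := fun i => (hγ0 i).le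
  have hpos : ∀ i, ∀ u ∈ S, 0 < f i u := fun i u hu => (hmul i).map_pos fun h => h0S (h ▸ hu)
  have hpow : ∀ u ∈ S, ∀ N : ℕ, u ^ N ∈ S := fun u hu N =>
    pow_mem (S := (⟨⟨S, fun {a b} ha hb => hS a ha b hb⟩, h1S⟩ : Submonoid A)) hu N
  have hsmall : ∀ C : Fin m → Fin n → ℝ, ∃ N : ℕ, ∀ i j, γ i ^ N * C i j < ε := fun C => by
    have h : ∀ i j, ∀ᶠ N : ℕ in atTop, γ i ^ N * C i j < ε := fun i j => by
      have := (tendsto_pow_atTop_nhds_zero_of_lt_one (hγ i) (hγ1 i)).mul_const (C i j)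
      rw [zero_mul] at this
      exact this.eventually_lt_const hε
    exact (eventually_all.2 fun i => eventually_all.2 (h i)).exists
  obtain ⟨M, hM⟩ := hsmall fun i j => f i (x j).2 / f i (x j).1
  choose c hc using fun j =>
    exists_norm_mul_pow_sub_mul_le hmul hγ hcomm (x j).1 (x j).2 M
  have htS : ∀ j, (x j).1 ^ M ∈ S := fun j => hpow _ (hx j) M
  obtain ⟨N, hN⟩ := hsmall fun i j => f i (c j) / f i ((x j).1 ^ M)
  let l := List.ofFn fun j => (x j).1 ^ M
  have hsS : (l.map (· ^ N)).prod ∈ S := by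
    refine list_prod_mem (S := (⟨⟨S, fun {a b} ha hb => hS a ha b hb⟩, h1S⟩ : Submonoid A)) ?_
    intro u hu
    obtain ⟨v, hv, rfl⟩ := List.mem_map.1 hu
    obtain ⟨j, rfl⟩ := (List.mem_ofFn' _ _).1 hv
    exact hpow _ (htS j) N
  choose b hb using fun j => exists_norm_mul_sub_prod_mul_le hmul hγ hcomm N (c j) ((x j).1 ^ M) l
    ((List.mem_ofFn' _ _).2 ⟨j, rfl⟩)
  refine ⟨_, hsS, b, fun j => ?_⟩
  have : Nonempty (Fin m) := ⟨⟨0, hm⟩⟩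
  obtain ⟨i, hi⟩ := exists_eq_ciSup_of_finite
    (f := fun i => dI (f i) S (x j) ((l.map (· ^ N)).prod, b j))
  rw [dGlob, ← hi]
  have hs := hpos i _ (hx j)
  have ht := hpos i _ (htS j)
  have hp := hpos i _ hsS
  refine (dI_le_max_Delta (hmul i) h1S h0S _ _ ((x j).1 ^ M, c j) (htS j)).trans_lt (max_lt ?_ ?_)
  · calc _ ≤ (f i (x j).1)⁻¹ * (f i ((x j).1 ^ M))⁻¹ *
          (γ i ^ M * (f i (x j).2 * f i ((x j).1 ^ M))) :=
          mul_le_mul_of_nonneg_left (hc j i) (by positivity)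
      _ = γ i ^ M * (f i (x j).2 / f i (x j).1) := by field_simp
      _ < ε := hM i j
  · calc _ ≤ (f i (l.map (· ^ N)).prod)⁻¹ * (f i ((x j).1 ^ M))⁻¹ *
          (γ i ^ N * (f i (l.map (· ^ N)).prod * f i (c j))) :=
          mul_le_mul_of_nonneg_left (hb j i) (by positivity)
      _ = γ i ^ N * (f i (c j) / f i ((x j).1 ^ M)) := by field_simp
      _ < ε := hN i j
end

section
/- Let |·| be a quasi-abelian multiplicative norm on A with constant 0 < γ < 1. Then for any elements e₁, …, eₙ ∈ A and any permutation σ of {1, …, n} one has |e₁⋯eₙ − e_{σ(1)}⋯e_{σ(n)}| ≤ γ·|e₁⋯eₙ|; in particular |e₁⋯eₙ| = |e_{σ(1)}⋯e_{σ(n)}|. -/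
/-- A multiplicative norm takes equal values on the products of a list and of any rearrangement. -/
theorem IsMultNorm.map_prod_eq_of_perm {A : Type*} [Ring A] {f : A → ℝ} (hf : IsMultNorm f)
    {l₁ l₂ : List A} (h : l₁.Perm l₂) : f l₁.prod = f l₂.prod := by
  obtain ⟨-, -, -, hone, hmul⟩ := hf
  let φ : A →* ℝ := ⟨⟨f, hone⟩, hmul⟩
  change φ l₁.prod = φ l₂.prod
  rw [map_list_prod, map_list_prod]
  exact (h.map φ).prod_eq

/-- If commutators are small relative to products, then so is the difference between the product
of a list and that of any rearrangement. -/
theorem IsMultNorm.map_prod_sub_prod_le_of_perm {A : Type*} [Ring A] {f : A → ℝ}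
    (hf : IsMultNorm f) {γ : ℝ} (hγ : 0 ≤ γ)
    (hqa : ∀ a b : A, f (a * b - b * a) ≤ γ * f (a * b))
    {l₁ l₂ : List A} (h : l₁.Perm l₂) : f (l₁.prod - l₂.prod) ≤ γ * f l₁.prod := by
  have ⟨hnonneg, hzero, hadd, _, hmul⟩ := hf
  induction h with
  | nil =>
    rw [sub_self, (hzero 0).2 rfl]
    exact mul_nonneg hγ (hnonneg _)
  | cons a _ ih =>
    rw [List.prod_cons, List.prod_cons, ← mul_sub, hmul, hmul, mul_left_comm]
    exact mul_le_mul_of_nonneg_left ih (hnonneg a)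
  | swap a b l =>
    simp only [List.prod_cons]
    rw [← mul_assoc, ← mul_assoc, ← sub_mul, hmul, hmul (b * a), ← mul_assoc]
    exact mul_le_mul_of_nonneg_right (hqa b a) (hnonneg _)
  | trans h₁ _ ih₁ ih₂ =>
    rw [← sub_add_sub_cancel]
    refine (hadd _ _).trans (max_le ih₁ ?_)
    rwa [hf.map_prod_eq_of_perm h₁]

theorem statement10 {A : Type*} [Ring A] (f : A → ℝ) (hf : IsMultNorm f)
    (γ : ℝ) (hγ0 : 0 < γ) (hγ1 : γ < 1)
    (hqa : ∀ a b : A, f (a * b - b * a) ≤ γ * f (a * b))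
    (n : ℕ) (e : Fin n → A) (σ : Equiv.Perm (Fin n)) :
    f ((List.ofFn e).prod - (List.ofFn (e ∘ σ)).prod) ≤ γ * f ((List.ofFn e).prod) ∧
    f ((List.ofFn e).prod) = f ((List.ofFn (e ∘ σ)).prod) := by
  have h : (List.ofFn e).Perm (List.ofFn (e ∘ σ)) := (σ.ofFn_comp_perm e).symm
  exact ⟨hf.map_prod_sub_prod_le_of_perm hγ0.le hqa h, hf.map_prod_eq_of_perm h⟩
end

section
/- (Logarithmic convexity of the family of norms |·|_ρ.) Let K be a normed field, D ≥ 1 an integer, and let (d_α)_{α ∈ ℕ^D} be a family of elements of K such that for every 0 < ρ < 1 the set {‖d_α‖·ρ^{deg α} : α ∈ ℕ^D} is bounded, where deg α := α₁ + ⋯ + α_D. For 0 < ρ < 1 put |μ|_ρ := sup_{α ∈ ℕ^D} ‖d_α‖·ρ^{deg α}. Then for any real numbers 0 < r ≤ r′ ≤ r″ < 1 and any integer m ≥ 0 one has |μ|_{r′}/r′^m ≤ max(|μ|_r/r^m, |μ|_{r″}/r″^m). -/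
open scoped BigOperators

theorem pow_div_pow_le_of_le_exponent {a b : ℝ} (ha : 0 < a) (hab : a ≤ b) {m k : ℕ}
    (hmk : m ≤ k) : a ^ k / a ^ m ≤ b ^ k / b ^ m := by
  obtain ⟨j, rfl⟩ := Nat.exists_eq_add_of_le hmk
  have hb : 0 < b := ha.trans_le hab
  rw [pow_add, pow_add, mul_div_cancel_left₀ _ (pow_pos ha m).ne',
    mul_div_cancel_left₀ _ (pow_pos hb m).ne']
  gcongr

theorem pow_div_pow_le_of_exponent_le {a b : ℝ} (ha : 0 < a) (hab : a ≤ b) {m k : ℕ}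
    (hkm : k ≤ m) : b ^ k / b ^ m ≤ a ^ k / a ^ m := by
  have hb : 0 < b := ha.trans_le hab
  have h := pow_div_pow_le_of_le_exponent ha hab hkm
  rw [← inv_div (b ^ m), ← inv_div (a ^ m)]
  exact inv_anti₀ (by positivity) h

theorem statement12 {K : Type*} [NormedField K] (D : ℕ) (hD : 1 ≤ D)
    (d : (Fin D → ℕ) → K)
    (hbd : ∀ ρ : ℝ, 0 < ρ → ρ < 1 →
      BddAbove (Set.range fun α : Fin D → ℕ => ‖d α‖ * ρ ^ (∑ i, α i)))
    (r r' r'' : ℝ) (h0r : 0 < r) (hrr' : r ≤ r') (hr'r'' : r' ≤ r'') (hr''1 : r'' < 1)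
    (m : ℕ) :
    (⨆ α : Fin D → ℕ, ‖d α‖ * r' ^ (∑ i, α i)) / r' ^ m ≤
      max ((⨆ α : Fin D → ℕ, ‖d α‖ * r ^ (∑ i, α i)) / r ^ m)
          ((⨆ α : Fin D → ℕ, ‖d α‖ * r'' ^ (∑ i, α i)) / r'' ^ m) := by
  have h0r' : 0 < r' := h0r.trans_le hrr'
  have h0r'' : 0 < r'' := h0r'.trans_le hr'r''
  rw [div_le_iff₀ (pow_pos h0r' m)]
  refine ciSup_le fun α => ?_
  rw [← div_le_iff₀ (pow_pos h0r' m), mul_div_assoc]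
  rcases le_total m (∑ i, α i) with h | h
  · refine le_max_of_le_right ?_
    calc ‖d α‖ * (r' ^ (∑ i, α i) / r' ^ m)
        ≤ ‖d α‖ * (r'' ^ (∑ i, α i) / r'' ^ m) :=
          mul_le_mul_of_nonneg_left (pow_div_pow_le_of_le_exponent h0r' hr'r'' h) (norm_nonneg _)
      _ = ‖d α‖ * r'' ^ (∑ i, α i) / r'' ^ m := (mul_div_assoc _ _ _).symm
      _ ≤ _ := div_le_div_of_nonneg_right (le_ciSup (hbd r'' h0r'' hr''1) α) (by positivity)
  · refine le_max_of_le_left ?_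
    have hr1 : r < 1 := (hrr'.trans hr'r'').trans_lt hr''1
    calc ‖d α‖ * (r' ^ (∑ i, α i) / r' ^ m)
        ≤ ‖d α‖ * (r ^ (∑ i, α i) / r ^ m) :=
          mul_le_mul_of_nonneg_left (pow_div_pow_le_of_exponent_le h0r hrr' h) (norm_nonneg _)
      _ = ‖d α‖ * r ^ (∑ i, α i) / r ^ m := (mul_div_assoc _ _ _).symm
      _ ≤ _ := div_le_div_of_nonneg_right (le_ciSup (hbd r h0r hr1) α) (by positivity)
end

section
/- Let K be a complete, discretely valued nonarchimedean normed field and D ≥ 1. Let (d_α)_{α ∈ ℤ^D} be a family of elements of K and suppose there is 0 < r₀ < 1 such that for every ρ ∈ [r₀, 1) one has ‖d_α‖·ρ^{deg α} → 0 as |α| → ∞. For ρ ∈ [r₀, 1) set N(ρ) := sup_{α} ‖d_α‖·ρ^{deg α} (a finite real number). Then: if sup_α ‖d_α‖ < ∞, then N(ρ) tends to sup_α ‖d_α‖ as ρ → 1 from below; and if sup_α ‖d_α‖ = ∞, then N(ρ) tends to +∞ as ρ → 1 from below. -/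
open Filter

/-- A real family of which only finitely many members are at least `1` is bounded above. -/
theorem bddAbove_range_of_finite_one_le {ι : Type*} {f : ι → ℝ} (h : {i | 1 ≤ f i}.Finite) :
    BddAbove (Set.range f) := by
  refine ((h.image f).bddAbove.union (bddAbove_Iic (a := 1))).mono ?_
  rintro _ ⟨i, rfl⟩
  rcases le_total 1 (f i) with hi | hi
  · exact Or.inl ⟨i, hi, rfl⟩
  · exact Or.inr hi

theorem tendsto_mul_zpow_nhdsWithin_one (a : ℝ) (n : ℤ) (s : Set ℝ) :
    Tendsto (fun ρ : ℝ => a * ρ ^ n) (nhdsWithin 1 s) (nhds a) := by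
  have h : ContinuousAt (fun ρ : ℝ => a * ρ ^ n) 1 :=
    continuousAt_const.mul (continuousAt_zpow₀ 1 n (Or.inl one_ne_zero))
  simpa using h.tendsto.mono_left nhdsWithin_le_nhds

/-- A weighted supremum eventually exceeds every number below some coefficient. -/
theorem eventually_lt_iSup_mul_zpow {ι : Type*} {a : ι → ℝ} {n : ι → ℤ} {s : Set ℝ}
    (hbdd : ∀ ρ ∈ s, BddAbove (Set.range fun i => a i * ρ ^ n i)) {b : ℝ} {i : ι}
    (hb : b < a i) :
    ∀ᶠ ρ in nhdsWithin 1 s, b < ⨆ i, a i * ρ ^ n i := by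
  filter_upwards [(tendsto_mul_zpow_nhdsWithin_one (a i) (n i) s).eventually_const_lt hb,
    self_mem_nhdsWithin] with ρ hρ hs
  exact hρ.trans_le (le_ciSup (hbdd ρ hs) i)

/-- If the coefficients are at most `M`, then the weighted supremum is eventually at most any
`b > M`, as soon as only finitely many terms reach `b` at the radius `r`. -/
theorem eventually_iSup_mul_zpow_le {ι : Type*} [Nonempty ι] {a : ι → ℝ} {n : ι → ℤ}
    {r M b : ℝ} (hr : 0 < r) (ha : ∀ i, 0 ≤ a i) (haM : ∀ i, a i ≤ M) (hb : M < b)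
    (hfin : {i | b ≤ a i * r ^ n i}.Finite) :
    ∀ᶠ ρ in nhdsWithin 1 (Set.Ico r 1), ⨆ i, a i * ρ ^ n i ≤ b := by
  have hS : ∀ᶠ ρ in nhdsWithin 1 (Set.Ico r 1),
      ∀ i ∈ {i | b ≤ a i * r ^ n i}, a i * ρ ^ n i < b :=
    (eventually_all_finite hfin).2 fun i _ =>
      (tendsto_mul_zpow_nhdsWithin_one (a i) (n i) _).eventually_lt_const ((haM i).trans_lt hb)
  filter_upwards [hS, self_mem_nhdsWithin] with ρ hρ hs
  have hρ0 : 0 < ρ := hr.trans_le hs.1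
  refine ciSup_le fun i => ?_
  by_cases hi : b ≤ a i * r ^ n i
  · exact (hρ i hi).le
  rcases le_total 0 (n i) with hn | hn
  · exact (mul_le_of_le_one_right (ha i) (zpow_le_one₀ hρ0 hs.2.le hn)).trans
      ((haM i).trans hb.le)
  · have hle : ρ ^ n i ≤ r ^ n i := by
      obtain ⟨k, hk⟩ := Int.exists_eq_neg_ofNat hn
      rw [hk, zpow_neg, zpow_neg, zpow_natCast, zpow_natCast]
      exact inv_anti₀ (pow_pos hr k) (pow_le_pow_left₀ hr.le hs.1 k)
    exact (mul_le_mul_of_nonneg_left hle (ha i)).trans (not_le.1 hi).le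

theorem statement17 {K : Type*} [NormedField K] [CompleteSpace K]
    (hna : ∀ a b : K, ‖a + b‖ ≤ max ‖a‖ ‖b‖)
    (hdisc : ∃ c : ℝ, 0 < c ∧ c < 1 ∧ ∀ x : K, x ≠ 0 → ∃ n : ℤ, ‖x‖ = c ^ n)
    (D : ℕ) (hD : 1 ≤ D) (d : (Fin D → ℤ) → K)
    (r₀ : ℝ) (h0 : 0 < r₀) (h1 : r₀ < 1)
    (hdec : ∀ ρ : ℝ, r₀ ≤ ρ → ρ < 1 → ∀ ε : ℝ, 0 < ε →
      {α : Fin D → ℤ | ε ≤ ‖d α‖ * ρ ^ (∑ i, α i)}.Finite) :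
    (BddAbove (Set.range fun α : Fin D → ℤ => ‖d α‖) →
      Tendsto (fun ρ : ℝ => ⨆ α : Fin D → ℤ, ‖d α‖ * ρ ^ (∑ i, α i))
        (nhdsWithin 1 (Set.Ico r₀ 1))
        (nhds (⨆ α : Fin D → ℤ, ‖d α‖))) ∧
    (¬ BddAbove (Set.range fun α : Fin D → ℤ => ‖d α‖) →
      Tendsto (fun ρ : ℝ => ⨆ α : Fin D → ℤ, ‖d α‖ * ρ ^ (∑ i, α i))
        (nhdsWithin 1 (Set.Ico r₀ 1)) atTop) := by
  have hbdd : ∀ ρ ∈ Set.Ico r₀ 1,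
      BddAbove (Set.range fun α : Fin D → ℤ => ‖d α‖ * ρ ^ (∑ i, α i)) := fun ρ hρ =>
    bddAbove_range_of_finite_one_le (hdec ρ hρ.1 hρ.2 1 one_pos)
  refine ⟨fun hM => tendsto_order.2 ⟨fun b hb => ?_, fun b hb => ?_⟩,
    fun hM => tendsto_atTop.2 fun b => ?_⟩
  · obtain ⟨α, hα⟩ := exists_lt_of_lt_ciSup hb
    exact eventually_lt_iSup_mul_zpow hbdd hα
  · obtain ⟨c, hc, hcb⟩ := exists_between hb
    have hc0 : 0 < c := (Real.iSup_nonneg fun α => norm_nonneg (d α)).trans_lt hc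
    filter_upwards [eventually_iSup_mul_zpow_le h0 (fun α => norm_nonneg (d α)) (le_ciSup hM) hc
      (hdec r₀ le_rfl h1 c hc0)] with ρ hρ
    exact hρ.trans_lt hcb
  · obtain ⟨_, ⟨α, rfl⟩, hα⟩ := not_bddAbove_iff.1 hM b
    exact (eventually_lt_iSup_mul_zpow hbdd hα).mono fun _ h => h.le
end
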